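/- Let L(w,z) = 2πi(w̄ − z)·K(w,z). Then L(i,i) > 0, and the entire function E(z) = L(i,z)/L(i,i)^{1/2} satisfies: (a) the Hermite–Biehler inequality |E(z̄)| < |E(z)| for every z with Im z > 0; and (b) the factorization L(w,z) = E(z)·conj(E(w)) − conj(E(z̄))·E(w̄) for all w, z ∈ ℂ. -/

import Mathlib

open Filter MeasureTheory Real Complex

/-- The constant `2^{-1/2}`. -/
noncomputable def invSqrt2 : ℝ := (Real.sqrt 2)⁻¹

/-- The entire extension of `sin z / z`. -/
noncomputable def csinc (z : ℂ) : ℂ := if z = 0 then 1 else Complex.sin z / z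

/-- The coefficient `c(w)`. -/
noncomputable def cCoef (w : ℂ) : ℂ :=
  (Complex.cos ((π : ℂ) * w) - (π : ℂ) * w * Complex.sin ((π : ℂ) * w)) /
    ((1 - 2 * (π : ℂ) ^ 2 * w ^ 2) *
      ((Real.cos invSqrt2 : ℂ) - (invSqrt2 : ℂ) * (Real.sin invSqrt2 : ℂ)))

/-- The coefficient `d(w)`. -/
noncomputable def dCoef (w : ℂ) : ℂ :=
  (2 * (π : ℂ) * w * Complex.cos ((π : ℂ) * w)) /
    ((1 - 2 * (π : ℂ) ^ 2 * w ^ 2) * (Real.sqrt 2 : ℂ) * (Real.cos invSqrt2 : ℂ))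

/-- `f(w,z) = (2π²w²/(2π²w²−1)) · sin π(z−w)/(π(z−w))` (with the removable singularity at
`z = w` filled in). -/
noncomputable def fFun (w z : ℂ) : ℂ :=
  (2 * (π : ℂ) ^ 2 * w ^ 2 / (2 * (π : ℂ) ^ 2 * w ^ 2 - 1)) * csinc ((π : ℂ) * (z - w))

/-- The value of `g` at the removable singularities `±1/(π√2)`. -/
noncomputable def gSingVal : ℂ := 1 / 2 + (Real.sin (Real.sqrt 2) / (2 * Real.sqrt 2) : ℝ)

/-- The value of `h` at the removable singularity `1/(π√2)`. -/
noncomputable def hSingVal : ℂ := 1 / 2 - (Real.sin (Real.sqrt 2) / (2 * Real.sqrt 2) : ℝ)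

/-- `g(z) = (√2 sin(2^{-1/2}) cos πz − 2πz cos(2^{-1/2}) sin πz)/(1 − 2π²z²)`, with the
removable singularities at `±1/(π√2)` filled in by continuity. -/
noncomputable def gFun (z : ℂ) : ℂ :=
  if 1 - 2 * (π : ℂ) ^ 2 * z ^ 2 = 0 then gSingVal
  else ((Real.sqrt 2 * Real.sin invSqrt2 : ℝ) * Complex.cos ((π : ℂ) * z)
      - 2 * (π : ℂ) * z * (Real.cos invSqrt2 : ℂ) * Complex.sin ((π : ℂ) * z)) /
    (1 - 2 * (π : ℂ) ^ 2 * z ^ 2)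

/-- `h(z) = (2πz sin(2^{-1/2}) cos πz − √2 cos(2^{-1/2}) sin πz)/(1 − 2π²z²)`, with the
removable singularities at `±1/(π√2)` filled in by continuity. -/
noncomputable def hFun (z : ℂ) : ℂ :=
  if z = ((π * Real.sqrt 2)⁻¹ : ℝ) then hSingVal
  else if z = -((π * Real.sqrt 2)⁻¹ : ℝ) then -hSingVal
  else (2 * (π : ℂ) * z * (Real.sin invSqrt2 : ℂ) * Complex.cos ((π : ℂ) * z)
      - (Real.sqrt 2 * Real.cos invSqrt2 : ℝ) * Complex.sin ((π : ℂ) * z)) /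
    (1 - 2 * (π : ℂ) ^ 2 * z ^ 2)

/-- The reproducing kernel `K(w,z) = f(w̄,z) + c(w̄) g(z) + d(w̄) h(z)` for the pair
correlation measure. -/
noncomputable def Kker (w z : ℂ) : ℂ :=
  fFun ((starRingEnd ℂ) w) z + cCoef ((starRingEnd ℂ) w) * gFun z
    + dCoef ((starRingEnd ℂ) w) * hFun z

/-- The pair correlation density `1 - (sin πx / (πx))²`. -/
noncomputable def pairCorKernel (x : ℝ) : ℝ := 1 - (Real.sin (π * x) / (π * x)) ^ 2

/-- The pair correlation measure `dμ(x) = {1 - (sin πx/(πx))²} dx`. -/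
noncomputable def pairCorMeasure : Measure ℝ :=
  volume.withDensity fun x => ENNReal.ofReal (pairCorKernel x)

/-- An entire function has exponential type at most `τ`. -/
def HasExpTypeLE (F : ℂ → ℂ) (τ : ℝ) : Prop :=
  ∀ ε > 0, ∃ C > 0, ∀ z : ℂ, ‖F z‖ ≤ C * Real.exp ((τ + ε) * ‖z‖)

/-- The kernel `K(w,z)` extended continuously in `w` across the (removable) singularities
at `2π²w² = 1`. -/
noncomputable def KkerExt (w z : ℂ) : ℂ :=
  limUnder (nhdsWithin w {w' : ℂ | 2 * (π : ℂ) ^ 2 * w' ^ 2 ≠ 1}) fun w' => Kker w' z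

/-- `L(w,z) = 2πi (w̄ − z) K(w,z)`. -/
noncomputable def Lker (w z : ℂ) : ℂ :=
  2 * (π : ℂ) * Complex.I * ((starRingEnd ℂ) w - z) * KkerExt w z

/-- The Hermite–Biehler function `E(z) = L(i,z)/L(i,i)^{1/2}`. -/
noncomputable def Efun (z : ℂ) : ℂ :=
  Lker Complex.I z / (Real.sqrt ((Lker Complex.I Complex.I).re) : ℂ)


lemma aux_s_sq : (invSqrt2) ^ 2 = 1 / 2 := by
  unfold invSqrt2
  rw [inv_pow, Real.sq_sqrt (by norm_num)]; norm_num

lemma aux_s_pos : 0 < invSqrt2 := by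
  unfold invSqrt2; positivity

lemma aux_sqrt2 : Real.sqrt 2 = 2 * invSqrt2 := by
  unfold invSqrt2
  have h : Real.sqrt 2 ^ 2 = 2 := Real.sq_sqrt (by norm_num)
  have h0 : Real.sqrt 2 ≠ 0 := by positivity
  field_simp
  linarith

lemma aux_s_lt_one : invSqrt2 < 1 := by
  have := aux_s_sq; have := aux_s_pos; nlinarith

lemma aux_cos_pos {x : ℝ} (h0 : 0 ≤ x) (h1 : x ≤ 1) : 0 < Real.cos (invSqrt2 * x) := by
  have := aux_s_pos
  have := aux_s_lt_one
  apply Real.cos_pos_of_mem_Ioo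
  have hpi := Real.pi_gt_three
  constructor <;> nlinarith

lemma aux_c0_pos : 0 < Real.cos invSqrt2 := by
  simpa using aux_cos_pos (x := 1) (by norm_num) le_rfl

/-- The denominator constant. -/
noncomputable def auxD : ℝ := Real.cos invSqrt2 - invSqrt2 * Real.sin invSqrt2

lemma auxD_pos : 0 < auxD := by
  unfold auxD
  have h1 := Real.sin_lt aux_s_pos
  have h2 := Real.one_sub_sq_div_two_le_cos (x := invSqrt2)
  have h3 := aux_s_sq
  have h4 := aux_s_pos
  nlinarith

lemma csinc_eq_dslope : csinc = dslope Complex.sin 0 := by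
  funext z
  unfold csinc
  split_ifs with h
  · subst h
    rw [dslope_same]; simp
  · rw [dslope_of_ne _ h, slope_def_field]; simp

lemma csinc_continuous : Continuous csinc := by
  rw [csinc_eq_dslope, continuous_iff_continuousAt]
  intro z
  by_cases h : z = 0
  · subst h
    exact continuousAt_dslope_same.2 Complex.differentiable_sin.differentiableAt
  · exact (continuousAt_dslope_of_ne h).2 Complex.continuous_sin.continuousAt

lemma csinc_conj (z : ℂ) : csinc ((starRingEnd ℂ) z) = (starRingEnd ℂ) (csinc z) := by
  unfold csinc
  by_cases h : z = 0
  · simp [h]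
  · simp [h, Complex.sin_conj]

lemma csinc_mul (z : ℂ) : z * csinc z = Complex.sin z := by
  unfold csinc
  split_ifs with h
  · simp [h]
  · field_simp

lemma aux_sC_sq : ((invSqrt2 : ℝ) : ℂ) ^ 2 = 1 / 2 := by
  rw [← Complex.ofReal_pow, aux_s_sq]
  push_cast
  rfl

lemma aux_sC_ne : ((invSqrt2 : ℝ) : ℂ) ≠ 0 := by
  exact_mod_cast aux_s_pos.ne'

lemma aux_den_iff (z : ℂ) : 1 - 2 * (π : ℂ) ^ 2 * z ^ 2 = 0 ↔
    ((π : ℂ) * z = invSqrt2 ∨ (π : ℂ) * z = -invSqrt2) := by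
  have h := aux_sC_sq
  rw [← sq_eq_sq_iff_eq_or_eq_neg, h]
  constructor
  · intro h; linear_combination (-1/2) * h
  · intro h; linear_combination (-2) * h

lemma aux_two_sin : Real.sin (Real.sqrt 2) = 2 * Real.sin invSqrt2 * Real.cos invSqrt2 := by
  rw [aux_sqrt2, Real.sin_two_mul]

lemma gFun_eq (z : ℂ) : gFun z =
    (csinc ((π : ℂ) * z - invSqrt2) + csinc ((π : ℂ) * z + invSqrt2)) / 2 := by
  have hs := aux_sC_ne
  have hs2 := aux_sC_sq
  have e2 : csinc ((invSqrt2 : ℂ) + invSqrt2) = Real.sin (Real.sqrt 2) / Real.sqrt 2 := by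
    unfold csinc
    rw [if_neg (by rw [← two_mul]; simpa using hs), aux_sqrt2]
    push_cast; rw [← two_mul]
  have e0 : csinc 0 = 1 := by simp [csinc]
  unfold gFun
  split_ifs with h
  · rcases (aux_den_iff z).1 h with h | h
    · rw [h, sub_self, e0, e2]; unfold gSingVal; push_cast; ring
    · rw [h, neg_add_cancel, e0, ← neg_add']
      have : csinc (-((invSqrt2 : ℂ) + invSqrt2)) = csinc ((invSqrt2 : ℂ) + invSqrt2) := by
        unfold csinc; simp only [neg_eq_zero, Complex.sin_neg, neg_div_neg_eq]
      rw [this, e2]; unfold gSingVal; push_cast; ring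
  · have h1 : (π : ℂ) * z - invSqrt2 ≠ 0 := fun h' =>
      h ((aux_den_iff z).2 (Or.inl (by linear_combination h')))
    have h2 : (π : ℂ) * z + invSqrt2 ≠ 0 := fun h' =>
      h ((aux_den_iff z).2 (Or.inr (by linear_combination h')))
    have hd : 1 - 2 * (π : ℂ) ^ 2 * z ^ 2 =
        -2 * (((π : ℂ) * z - invSqrt2) * ((π : ℂ) * z + invSqrt2)) := by
      linear_combination (-2) * hs2
    unfold csinc
    rw [if_neg h1, if_neg h2, hd, aux_sqrt2, Complex.sin_sub, Complex.sin_add]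
    push_cast
    field_simp
    ring

lemma gFun_continuous : Continuous gFun := by
  have : gFun = fun z => (csinc ((π : ℂ) * z - invSqrt2) + csinc ((π : ℂ) * z + invSqrt2)) / 2 :=
    funext gFun_eq
  rw [this]
  have h := csinc_continuous
  fun_prop

lemma gFun_conj (z : ℂ) : gFun ((starRingEnd ℂ) z) = (starRingEnd ℂ) (gFun z) := by
  rw [gFun_eq, gFun_eq, map_div₀, map_add, ← csinc_conj, ← csinc_conj]
  simp only [map_sub, map_add, map_mul, Complex.conj_ofReal, map_ofNat]

lemma gFun_mul (z : ℂ) : (1 - 2 * (π : ℂ) ^ 2 * z ^ 2) * gFun z =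
    2 * invSqrt2 * Complex.sin invSqrt2 * Complex.cos ((π : ℂ) * z)
      - 2 * (π : ℂ) * z * Complex.cos invSqrt2 * Complex.sin ((π : ℂ) * z) := by
  have hs2 := aux_sC_sq
  have h1 := csinc_mul ((π : ℂ) * z - invSqrt2)
  have h2 := csinc_mul ((π : ℂ) * z + invSqrt2)
  rw [gFun_eq]
  rw [Complex.sin_sub] at h1
  rw [Complex.sin_add] at h2
  linear_combination (-(π * z + invSqrt2)) * h1 - (π * z - invSqrt2) * h2
    - (csinc ((π : ℂ) * z - invSqrt2) + csinc ((π : ℂ) * z + invSqrt2)) * hs2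

lemma hFun_eq (z : ℂ) : hFun z = 2 * invSqrt2 * (π * z) * gFun z
    - 2 * invSqrt2 * Complex.cos invSqrt2 * Complex.sin ((π : ℂ) * z) := by
  have hs := aux_sC_ne
  have hs2 := aux_sC_sq
  have hpi : (π : ℂ) ≠ 0 := by exact_mod_cast Real.pi_ne_zero
  have key : (((π * Real.sqrt 2)⁻¹ : ℝ) : ℂ) = invSqrt2 / π := by
    unfold invSqrt2; push_cast; field_simp
  have i1 : z = ((π * Real.sqrt 2)⁻¹ : ℝ) ↔ (π : ℂ) * z = invSqrt2 := by
    rw [key, eq_div_iff hpi, mul_comm]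
  have i2 : z = -((π * Real.sqrt 2)⁻¹ : ℝ) ↔ (π : ℂ) * z = -invSqrt2 := by
    rw [key, ← neg_div, eq_div_iff hpi, mul_comm]
  have hg (h : 1 - 2 * (π : ℂ) ^ 2 * z ^ 2 = 0) : gFun z = gSingVal := if_pos h
  have hts : Complex.sin invSqrt2 * Complex.cos invSqrt2 = Real.sin (Real.sqrt 2) / 2 := by
    rw [aux_two_sin]; push_cast; ring
  have hv : (Real.sin (Real.sqrt 2) / (2 * Real.sqrt 2) : ℝ) =
      (invSqrt2 * Real.sin (Real.sqrt 2) / 2 : ℂ) := by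
    unfold invSqrt2; push_cast; ring
  unfold hFun
  simp only [i1, i2]
  split_ifs with h1 h2
  · rw [hg ((aux_den_iff z).2 (Or.inl h1)), h1]
    unfold hSingVal gSingVal
    rw [hv]
    linear_combination (2 * invSqrt2) * hts - (1 + invSqrt2 * Real.sin (Real.sqrt 2)) * hs2
  · rw [hg ((aux_den_iff z).2 (Or.inr h2)), h2, Complex.sin_neg]
    unfold hSingVal gSingVal
    rw [hv]
    linear_combination (-2 * invSqrt2) * hts + (1 + invSqrt2 * Real.sin (Real.sqrt 2)) * hs2
  · have hd : 1 - 2 * (π : ℂ) ^ 2 * z ^ 2 ≠ 0 := fun h => by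
      rcases (aux_den_iff z).1 h with h | h
      exacts [h1 h, h2 h]
    rw [div_eq_iff hd, aux_sqrt2]
    push_cast
    linear_combination (-2 * invSqrt2 * (π * z)) * gFun_mul z
      - (4 * π * z * Complex.sin invSqrt2 * Complex.cos (π * z)) * hs2

/-- even companion function -/
noncomputable def auxP (z : ℂ) : ℂ :=
  (gFun z + 2 * auxD * Complex.cos (π * z)) / (2 * Real.cos invSqrt2)

/-- odd companion function -/
noncomputable def auxQ (z : ℂ) : ℂ := -(π * z * gFun z) / (2 * auxD)

lemma auxP_conj (z : ℂ) : auxP ((starRingEnd ℂ) z) = (starRingEnd ℂ) (auxP z) := by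
  unfold auxP
  simp only [gFun_conj, map_div₀, map_add, map_mul, Complex.conj_ofReal, ← Complex.cos_conj, map_ofNat]

lemma auxQ_conj (z : ℂ) : auxQ ((starRingEnd ℂ) z) = (starRingEnd ℂ) (auxQ z) := by
  unfold auxQ
  simp only [gFun_conj, map_div₀, map_neg, map_mul, Complex.conj_ofReal, map_ofNat]

lemma auxP_continuous : Continuous auxP := by
  have := gFun_continuous
  unfold auxP
  fun_prop

lemma auxQ_continuous : Continuous auxQ := by
  have := gFun_continuous
  unfold auxQ
  fun_prop

/-- algebraic core -/
lemma aux_alg (a b ca sa cb sb c0 s0 s D G Ga e k : ℂ) (hs : s ^ 2 = 1 / 2) (hs0 : s ≠ 0)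
    (hc : c0 ≠ 0) (hD : D ≠ 0) (hDe : D = c0 - s * s0) (he : e ≠ 0) (hea : e = 1 - 2 * a ^ 2)
    (hG : (1 - 2 * b ^ 2) * G = 2 * s * s0 * cb - 2 * b * c0 * sb)
    (hGa : e * Ga = 2 * s * s0 * ca - 2 * a * c0 * sa)
    (hk : (b - a) * k = sb * ca - cb * sa) :
    (a - b) * (2 * a ^ 2 / (-e) * k + (ca - a * sa) / (e * D) * G +
      2 * a * ca / (e * (2 * s) * c0) * (2 * s * b * G - 2 * s * c0 * sb)) =
    2 * ((Ga + 2 * D * ca) / (2 * c0) * (-(b * G) / (2 * D)) -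
      (-(a * Ga) / (2 * D)) * ((G + 2 * D * cb) / (2 * c0))) := by
  have hGa' : Ga = (2 * s * s0 * ca - 2 * a * c0 * sa) / e := by
    rw [eq_div_iff he]; linear_combination hGa
  have h1 : (a - b) * (2 * a ^ 2 / (-e) * k + (ca - a * sa) / (e * D) * G +
      2 * a * ca / (e * (2 * s) * c0) * (2 * s * b * G - 2 * s * c0 * sb)) =
      2 * a ^ 2 / e * (sb * ca - cb * sa) + (a - b) * ((ca - a * sa) / (e * D) * G +
      2 * a * ca / (e * c0) * (b * G - c0 * sb)) := by
    rw [← hk]; field_simp; ring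
  rw [h1, hGa']
  field_simp
  subst hDe hea
  linear_combination (a * ca * (c0 - s * s0)) * hG

lemma Kker_formula (w z : ℂ) (hw : 2 * (π : ℂ) ^ 2 * w ^ 2 ≠ 1) :
    2 * (π : ℂ) * Complex.I * ((starRingEnd ℂ) w - z) * Kker w z =
    4 * Complex.I * (auxP ((starRingEnd ℂ) w) * auxQ z - auxQ ((starRingEnd ℂ) w) * auxP z) := by
  have hw' : 1 - 2 * (π : ℂ) ^ 2 * ((starRingEnd ℂ) w) ^ 2 ≠ 0 := by
    intro h
    apply hw
    have := congrArg (starRingEnd ℂ) h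
    simp only [map_sub, map_one, map_mul, map_pow, map_ofNat, Complex.conj_ofReal,
      Complex.conj_conj, map_zero] at this
    linear_combination -this
  unfold Kker
  generalize (starRingEnd ℂ) w = u at *
  have hk : (π * z - π * u) * csinc ((π : ℂ) * (z - u)) =
      Complex.sin (π * z) * Complex.cos (π * u) - Complex.cos (π * z) * Complex.sin (π * u) := by
    rw [← mul_sub, csinc_mul, mul_sub, Complex.sin_sub]
  have hc : Complex.cos invSqrt2 ≠ 0 := by
    rw [← Complex.ofReal_cos]; exact_mod_cast aux_c0_pos.ne'
  have hD : (auxD : ℂ) ≠ 0 := by exact_mod_cast auxD_pos.ne'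
  have hDe : (auxD : ℂ) = Complex.cos invSqrt2 - invSqrt2 * Complex.sin invSqrt2 := by
    unfold auxD; push_cast; rfl
  have main := aux_alg (π * u) (π * z) (Complex.cos (π * u)) (Complex.sin (π * u))
    (Complex.cos (π * z)) (Complex.sin (π * z)) (Complex.cos invSqrt2) (Complex.sin invSqrt2)
    invSqrt2 auxD (gFun z) (gFun u) (1 - 2 * (π : ℂ) ^ 2 * u ^ 2) (csinc ((π : ℂ) * (z - u)))
    aux_sC_sq aux_sC_ne hc hD hDe hw' (by ring)
    (by linear_combination gFun_mul z) (by linear_combination gFun_mul u) hk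
  unfold auxP auxQ fFun cCoef dCoef
  rw [hFun_eq, aux_sqrt2]
  have hneg : 2 * (π : ℂ) ^ 2 * u ^ 2 - 1 = -(1 - 2 * (π : ℂ) ^ 2 * u ^ 2) := by ring
  rw [hneg]
  push_cast
  rw [← hDe]
  generalize (1 - 2 * (π : ℂ) ^ 2 * u ^ 2) = e at *
  linear_combination (2 * Complex.I) * main

lemma aux_neBot (w : ℂ) : (nhdsWithin w {w' : ℂ | 2 * (π : ℂ) ^ 2 * w' ^ 2 ≠ 1}).NeBot := by
  rw [← mem_closure_iff_nhdsWithin_neBot]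
  have hpi : (π : ℂ) ≠ 0 := by exact_mod_cast Real.pi_ne_zero
  have hsub : ({(invSqrt2 / π : ℂ), (-invSqrt2 / π : ℂ)} : Set ℂ)ᶜ ⊆
      {w' : ℂ | 2 * (π : ℂ) ^ 2 * w' ^ 2 ≠ 1} := by
    intro x hx h
    apply hx
    have h' : 1 - 2 * (π : ℂ) ^ 2 * x ^ 2 = 0 := by linear_combination -h
    rcases (aux_den_iff x).1 h' with h2 | h2
    · left; rw [eq_div_iff hpi, mul_comm]; exact h2
    · right; rw [Set.mem_singleton_iff, eq_div_iff hpi, mul_comm]; exact h2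
  have hd : Dense ({(invSqrt2 / π : ℂ), (-invSqrt2 / π : ℂ)} : Set ℂ)ᶜ :=
    Set.Countable.dense_compl ℝ (Set.toFinite _).countable
  exact (hd.mono hsub) w

lemma Lker_formula (w z : ℂ) : Lker w z =
    4 * Complex.I * (auxP ((starRingEnd ℂ) w) * auxQ z - auxQ ((starRingEnd ℂ) w) * auxP z) := by
  unfold Lker
  by_cases hwz : (starRingEnd ℂ) w = z
  · rw [hwz]; ring
  have hpi : (π : ℂ) ≠ 0 := by exact_mod_cast Real.pi_ne_zero
  have hne : (starRingEnd ℂ) w - z ≠ 0 := sub_ne_zero.2 hwz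
  have hcon : Continuous (starRingEnd ℂ) := Complex.continuous_conj
  have hP := auxP_continuous
  have hQ := auxQ_continuous
  have hlim : KkerExt w z = 4 * Complex.I * (auxP ((starRingEnd ℂ) w) * auxQ z
      - auxQ ((starRingEnd ℂ) w) * auxP z) /
      (2 * (π : ℂ) * Complex.I * ((starRingEnd ℂ) w - z)) := by
    unfold KkerExt
    have := aux_neBot w
    apply Tendsto.limUnder_eq
    have hc : ContinuousAt (fun w' : ℂ => 4 * Complex.I * (auxP ((starRingEnd ℂ) w') * auxQ z
      - auxQ ((starRingEnd ℂ) w') * auxP z) /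
      (2 * (π : ℂ) * Complex.I * ((starRingEnd ℂ) w' - z))) w := by
      apply ContinuousAt.div
      · fun_prop
      · fun_prop
      · simp [hpi, hne]
    refine (hc.tendsto.mono_left nhdsWithin_le_nhds).congr' ?_
    have hev : ∀ᶠ w' in nhds w, (starRingEnd ℂ) w' - z ≠ 0 :=
      ContinuousAt.eventually_ne (by fun_prop) hne
    filter_upwards [self_mem_nhdsWithin, nhdsWithin_le_nhds hev] with w' h1 h2
    rw [← Kker_formula w' z h1, mul_div_cancel_left₀]
    simp [hpi, h2]
  rw [hlim, mul_div_cancel₀]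
  simp [hpi, hne]

lemma aux_mono (b : ℂ) (hb : 0 < b.im) :
    ((starRingEnd ℂ) b * (invSqrt2 ^ 2 - b ^ 2) * Complex.cos b *
      (-(starRingEnd ℂ) b * Complex.sin ((starRingEnd ℂ) b) +
        invSqrt2 * Complex.tan invSqrt2 * Complex.cos ((starRingEnd ℂ) b))).im < 0 := by
  set β := (starRingEnd ℂ) b with hβ
  set s : ℂ := (invSqrt2 : ℂ) with hs
  let F : ℂ → ℂ := fun x => Complex.I * (β * (s ^ 2 - b ^ 2) * Complex.cos (b * x) *
      (-β * Complex.sin (β * x) + s * Complex.tan (s * x) * Complex.cos (β * x)))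
  have hder : ∀ x : ℝ, 0 ≤ x → x ≤ 1 → HasDerivAt (fun t : ℝ => (F t).re)
      (b.im * ((invSqrt2 ^ 2 + Complex.normSq b) *
        Complex.normSq (-b * Complex.sin (b * x) + s * Complex.tan (s * x) * Complex.cos (b * x))
        + Complex.normSq (s ^ 2 - b ^ 2) * Complex.normSq (Complex.cos (b * x)))) x := by
    intro x h0 h1
    have hc : Complex.cos (s * x) ≠ 0 := by
      rw [hs, ← Complex.ofReal_mul, ← Complex.ofReal_cos]
      exact_mod_cast (aux_cos_pos h0 h1).ne'
    have lin : ∀ k : ℂ, HasDerivAt (fun t : ℂ => k * t) k (x : ℂ) := fun k => by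
      simpa using (hasDerivAt_id (x : ℂ)).const_mul k
    have dcb := (lin b).ccos
    have dcβ := (lin β).ccos
    have dsβ := (lin β).csin
    have dt := (Complex.hasDerivAt_tan hc).comp (x : ℂ) (lin s)
    have dF := ((dcb.const_mul (β * (s ^ 2 - b ^ 2))).mul
      ((dsβ.const_mul (-β)).add ((dt.const_mul s).mul dcβ))).const_mul Complex.I
    have hF := HasDerivAt.real_of_complex (e := F) (dF.congr_deriv rfl)
    refine hF.congr_deriv ?_
    have hθ : -β * Complex.sin (β * x) + s * Complex.tan (s * x) * Complex.cos (β * x) =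
        (starRingEnd ℂ) (-b * Complex.sin (b * x) +
          s * Complex.tan (s * x) * Complex.cos (b * x)) := by
      simp [hβ, hs, ← Complex.sin_conj, ← Complex.cos_conj, ← Complex.tan_conj]
    have hC : Complex.cos (β * x) = (starRingEnd ℂ) (Complex.cos (b * x)) := by
      simp [hβ, ← Complex.cos_conj]
    have hsβ : s ^ 2 - β ^ 2 = (starRingEnd ℂ) (s ^ 2 - b ^ 2) := by
      simp [hβ, hs]
    have ht : 1 / Complex.cos (s * x) ^ 2 = 1 + Complex.tan (s * x) ^ 2 := by
      rw [Complex.tan_eq_sin_div_cos]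
      field_simp
      linear_combination -Complex.sin_sq_add_cos_sq (s * x)
    have key : Complex.I * (β * (s ^ 2 - b ^ 2)) * (Complex.normSq (-b * Complex.sin (b * x)
          + s * Complex.tan (s * x) * Complex.cos (b * x)) : ℂ)
        + Complex.I * β * (Complex.normSq (s ^ 2 - b ^ 2) : ℂ)
          * (Complex.normSq (Complex.cos (b * x)) : ℂ) =
        Complex.I * (β * (s ^ 2 - b ^ 2) * (-Complex.sin (b * x) * b) *
          (-β * Complex.sin (β * x) + s * Complex.tan (s * x) * Complex.cos (β * x)) +
          β * (s ^ 2 - b ^ 2) * Complex.cos (b * x) *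
          (-β * (Complex.cos (β * x) * β) +
            (s * (1 / Complex.cos (s * x) ^ 2 * s) * Complex.cos (β * x) +
              s * Complex.tan (s * x) * (-Complex.sin (β * x) * β)))) := by
      rw [← Complex.mul_conj, ← Complex.mul_conj, ← Complex.mul_conj, ← hθ, ← hC, ← hsβ, ht]
      ring
    refine Eq.trans (congrArg Complex.re ?_) (Eq.trans (congrArg Complex.re key.symm) ?_)
    · simp
    · have hs2 : s ^ 2 = ((invSqrt2 ^ 2 : ℝ) : ℂ) := by rw [hs]; push_cast; rfl
      rw [Complex.add_re, Complex.re_mul_ofReal, Complex.re_mul_ofReal,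
        Complex.re_mul_ofReal]
      have e1 : (Complex.I * (β * (s ^ 2 - b ^ 2))).re =
          b.im * (invSqrt2 ^ 2 + Complex.normSq b) := by
        rw [hs2, hβ, Complex.normSq_apply, sq b]
        simp only [Complex.mul_re, Complex.mul_im, Complex.I_re, Complex.I_im, Complex.sub_re,
          Complex.sub_im, Complex.ofReal_re, Complex.ofReal_im, Complex.conj_re, Complex.conj_im]
        ring
      have e2 : (Complex.I * β).re = b.im := by simp [hβ]
      rw [e1, e2]; ring
  have hmono : StrictMonoOn (fun t : ℝ => (F t).re) (Set.Icc 0 1) := by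
    apply strictMonoOn_of_deriv_pos (convex_Icc 0 1)
    · intro x hx
      exact (hder x hx.1 hx.2).continuousAt.continuousWithinAt
    · intro x hx
      rw [interior_Icc] at hx
      rw [(hder x hx.1.le hx.2.le).deriv]
      have hb0 : b ≠ 0 := by rintro rfl; simp at hb
      have hsb : s ^ 2 - b ^ 2 ≠ 0 := by
        intro h
        have h' : (s - b) * (s + b) = 0 := by linear_combination h
        rcases mul_eq_zero.1 h' with h | h
        · have := congrArg Complex.im h
          simp [hs] at this; linarith
        · have := congrArg Complex.im h
          simp [hs] at this; linarith
      have n1 := Complex.normSq_pos.2 hb0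
      have n2 := Complex.normSq_pos.2 hsb
      have s2 : 0 < invSqrt2 ^ 2 := pow_pos aux_s_pos 2
      apply mul_pos hb
      by_cases hC : Complex.cos (b * x) = 0
      · have hS : Complex.sin (b * x) ≠ 0 := by
          intro h
          have := Complex.sin_sq_add_cos_sq (b * x)
          rw [h, hC] at this; norm_num at this
        have n3 : 0 < Complex.normSq (-b * Complex.sin (b * x) +
            s * Complex.tan (s * x) * Complex.cos (b * x)) := by
          apply Complex.normSq_pos.2
          rw [hC]; simp [hb0, hS]
        have n4 := Complex.normSq_nonneg (Complex.cos (b * x))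
        positivity
      · have n3 := Complex.normSq_pos.2 hC
        have n4 := Complex.normSq_nonneg (-b * Complex.sin (b * x) +
            s * Complex.tan (s * x) * Complex.cos (b * x))
        positivity
  have h01 := hmono (Set.left_mem_Icc.2 zero_le_one) (Set.right_mem_Icc.2 zero_le_one) zero_lt_one
  simp only [F, Complex.ofReal_zero, Complex.ofReal_one, mul_zero, mul_one, Complex.sin_zero,
    Complex.tan_zero, zero_mul, add_zero, Complex.zero_re, Complex.I_mul_re] at h01
  linarith

lemma Lker_pos (z : ℂ) (hz : 0 < z.im) : 0 < (Lker z z).re ∧ (Lker z z).im = 0 := by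
  have hc0 := aux_c0_pos
  have hD := auxD_pos
  have hval : Lker z z = ((8 * (auxP z * (starRingEnd ℂ) (auxQ z)).im : ℝ) : ℂ) := by
    rw [Lker_formula, auxP_conj, auxQ_conj]
    apply Complex.ext
    · simp; ring
    · simp; ring
  rw [hval]
  refine ⟨?_, Complex.ofReal_im _⟩
  rw [Complex.ofReal_re]
  have hb : 0 < ((π : ℂ) * z).im := by
    rw [Complex.im_ofReal_mul]; exact mul_pos Real.pi_pos hz
  have hm := aux_mono _ hb
  have hg := gFun_mul z
  unfold auxP auxQ
  set b : ℂ := (π : ℂ) * z with hbdef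
  have hgc := congrArg (starRingEnd ℂ) hg
  have hcC : Complex.cos invSqrt2 ≠ 0 := by
    rw [← Complex.ofReal_cos]; exact_mod_cast hc0.ne'
  have hDC : (auxD : ℂ) ≠ 0 := by exact_mod_cast hD.ne'
  have hfac : (invSqrt2 : ℂ) ^ 2 - b ^ 2 = (1 - 2 * (π : ℂ) ^ 2 * z ^ 2) / 2 := by
    rw [aux_sC_sq, hbdef]; ring
  have hθ : Real.cos invSqrt2 * (-(starRingEnd ℂ) b * Complex.sin ((starRingEnd ℂ) b) +
        invSqrt2 * Complex.tan invSqrt2 * Complex.cos ((starRingEnd ℂ) b)) =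
      (starRingEnd ℂ) ((invSqrt2 : ℂ) ^ 2 - b ^ 2) * (starRingEnd ℂ) (gFun z) := by
    rw [← map_mul, hfac]
    have : (1 - 2 * (π : ℂ) ^ 2 * z ^ 2) / 2 * gFun z = invSqrt2 * Complex.sin invSqrt2 *
        Complex.cos b - b * Complex.cos invSqrt2 * Complex.sin b := by
      rw [hbdef] at *
      linear_combination hg / 2
    rw [this, Complex.tan_eq_sin_div_cos]
    simp only [map_sub, map_mul, Complex.conj_ofReal, ← Complex.sin_conj, ← Complex.cos_conj]
    push_cast
    field_simp
    ring
  have hX : Real.cos invSqrt2 * ((starRingEnd ℂ) b * (invSqrt2 ^ 2 - b ^ 2) * Complex.cos b *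
      (-(starRingEnd ℂ) b * Complex.sin ((starRingEnd ℂ) b) +
        invSqrt2 * Complex.tan invSqrt2 * Complex.cos ((starRingEnd ℂ) b))) =
      (Complex.normSq ((invSqrt2 : ℂ) ^ 2 - b ^ 2) : ℂ) *
        ((starRingEnd ℂ) b * Complex.cos b * (starRingEnd ℂ) (gFun z)) := by
    rw [← Complex.mul_conj]
    linear_combination ((starRingEnd ℂ) b * (invSqrt2 ^ 2 - b ^ 2) * Complex.cos b) * hθ
  have hXi := congrArg Complex.im hX
  rw [Complex.im_ofReal_mul, Complex.im_ofReal_mul] at hXi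
  have hneg : ((starRingEnd ℂ) b * Complex.cos b * (starRingEnd ℂ) (gFun z)).im < 0 := by
    by_contra! hcon
    have h1 := mul_nonneg (Complex.normSq_nonneg ((invSqrt2 : ℂ) ^ 2 - b ^ 2)) hcon
    have h2 := mul_neg_of_pos_of_neg hc0 hm
    linarith
  have hPQ : (gFun z + 2 * auxD * Complex.cos b) / (2 * Real.cos invSqrt2) *
      (starRingEnd ℂ) (-(b * gFun z) / (2 * auxD)) =
      ((1 / (4 * Real.cos invSqrt2 * auxD) : ℝ) : ℂ) * (-((Complex.normSq (gFun z) : ℝ) *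
        (starRingEnd ℂ) b) - ((2 * auxD : ℝ) : ℂ) *
          ((starRingEnd ℂ) b * Complex.cos b * (starRingEnd ℂ) (gFun z))) := by
    rw [← Complex.mul_conj]
    simp only [map_div₀, map_neg, map_mul, Complex.conj_ofReal, map_ofNat]
    push_cast
    field_simp
    ring
  rw [hPQ, Complex.im_ofReal_mul, Complex.sub_im, Complex.neg_im, Complex.im_ofReal_mul,
    Complex.im_ofReal_mul, Complex.conj_im]
  have h3 := mul_nonneg (Complex.normSq_nonneg (gFun z)) hb.le
  have h4 : 2 * auxD * ((starRingEnd ℂ) b * Complex.cos b * (starRingEnd ℂ) (gFun z)).im < 0 :=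
    mul_neg_of_pos_of_neg (by positivity) hneg
  apply mul_pos (by norm_num)
  apply mul_pos (by positivity)
  linarith

theorem hermite_biehler_structure :
    (0 < (Lker Complex.I Complex.I).re ∧ (Lker Complex.I Complex.I).im = 0) ∧
    (∀ z : ℂ, 0 < z.im → ‖Efun ((starRingEnd ℂ) z)‖ < ‖Efun z‖) ∧
    (∀ w z : ℂ, Lker w z =
      Efun z * (starRingEnd ℂ) (Efun w) -
        (starRingEnd ℂ) (Efun ((starRingEnd ℂ) z)) * Efun ((starRingEnd ℂ) w)) := by
  have hI := Lker_pos Complex.I (by simp)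
  have hb : ∀ w z : ℂ, Lker w z =
      Efun z * (starRingEnd ℂ) (Efun w) -
        (starRingEnd ℂ) (Efun ((starRingEnd ℂ) z)) * Efun ((starRingEnd ℂ) w) := by
    intro w z
    have hr : (Real.sqrt ((Lker Complex.I Complex.I).re) : ℂ) ^ 2 = Lker Complex.I Complex.I := by
      rw [← Complex.ofReal_pow, Real.sq_sqrt hI.1.le]
      apply Complex.ext <;> simp [hI.2]
    have hr0 : (Real.sqrt ((Lker Complex.I Complex.I).re) : ℂ) ≠ 0 := by
      exact_mod_cast (Real.sqrt_pos.2 hI.1).ne'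
    unfold Efun
    set r : ℂ := (Real.sqrt ((Lker Complex.I Complex.I).re) : ℂ) with hrdef
    have hrc : (starRingEnd ℂ) r = r := by rw [hrdef, Complex.conj_ofReal]
    simp only [map_div₀, hrc]
    field_simp
    rw [hr]
    simp only [Lker_formula, map_mul, map_sub, map_ofNat, Complex.conj_I, ← auxP_conj,
      ← auxQ_conj, Complex.conj_conj, map_neg, neg_neg]
    ring
  refine ⟨hI, ?_, hb⟩
  intro z hz
  have h1 := (Lker_pos z hz).1
  rw [hb z z, Complex.mul_conj, mul_comm, Complex.mul_conj, ← Complex.ofReal_sub,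
    Complex.ofReal_re, Complex.normSq_eq_norm_sq, Complex.normSq_eq_norm_sq] at h1
  exact lt_of_pow_lt_pow_left₀ 2 (norm_nonneg _) (by linarith)
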